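/- arXiv:0712.1669 — 2 statements merged into one kernel-verified Lean document; each statement's English description precedes it below -/
import Mathlib

section
/- Let c₂ < c₁, α ∈ [c₂,c₁], a(t,x) = c₁ H(αt - x) + c₂ H(x - αt) and u = 1 + t(c₁ - c₂) δ(x - αt). With the model product [H(αt-x)·δ(x-αt)] = δ(x-αt)/2 = [H(x-αt)·δ(x-αt)], the distribution u satisfies ∂_t u + ∂_x [a · u] = 0 in 𝒟'((0,T)×ℝ) if and only if α = (c₁+c₂)/2. -/
open MeasureTheory

/-- The restriction of a compactly supported function to the graph of a continuous function is
compactly supported. -/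
theorem HasCompactSupport.comp_graph {X Y E : Type*} [TopologicalSpace X] [TopologicalSpace Y]
    [T2Space X] [T2Space Y] [Zero E] {f : X × Y → E} (hf : HasCompactSupport f) {g : X → Y}
    (hg : Continuous g) : HasCompactSupport fun t => f (t, g t) :=
  hf.comp_isClosedEmbedding (Function.LeftInverse.isClosedEmbedding (f := Prod.fst)
    (fun _ => rfl) continuous_fst (by fun_prop))

/-- The restriction of a compactly supported function to a slice `{x} × Y` is
compactly supported. -/
theorem HasCompactSupport.comp_prodMk_left {X Y E : Type*} [TopologicalSpace X]
    [TopologicalSpace Y] [T2Space X] [T2Space Y] [Zero E] {f : X × Y → E}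
    (hf : HasCompactSupport f) (x : X) : HasCompactSupport fun y => f (x, y) :=
  hf.comp_isClosedEmbedding (Function.LeftInverse.isClosedEmbedding (f := Prod.snd)
    (fun _ => rfl) continuous_snd (by fun_prop))

theorem HasFDerivAt.hasDerivAt_comp_line {f : ℝ × ℝ → ℝ} {L : ℝ × ℝ →L[ℝ] ℝ} {α t : ℝ}
    (hf : HasFDerivAt f L (t, α * t)) :
    HasDerivAt (fun s => f (s, α * s)) (L (1, 0) + α * L (0, 1)) t := by
  have h : HasDerivAt (fun s : ℝ => (s, α * s)) ((1 : ℝ), α) t := by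
    simpa using (hasDerivAt_id t).prodMk ((hasDerivAt_id t).const_mul α)
  have key : L (1, α) = L (1, 0) + α * L (0, 1) := by
    rw [← smul_eq_mul, ← map_smul, ← map_add]
    simp
  exact key ▸ hf.comp_hasDerivAt t h

theorem HasFDerivAt.hasDerivAt_fst {f : ℝ × ℝ → ℝ} {L : ℝ × ℝ →L[ℝ] ℝ} {t x : ℝ}
    (hf : HasFDerivAt f L (t, x)) : HasDerivAt (fun s => f (s, x)) (L (1, 0)) t :=
  hf.comp_hasDerivAt t ((hasDerivAt_id t).prodMk (hasDerivAt_const t x))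

theorem HasFDerivAt.hasDerivAt_snd {f : ℝ × ℝ → ℝ} {L : ℝ × ℝ →L[ℝ] ℝ} {t x : ℝ}
    (hf : HasFDerivAt f L (t, x)) : HasDerivAt (fun y => f (t, y)) (L (0, 1)) x :=
  hf.comp_hasDerivAt x ((hasDerivAt_const x t).prodMk (hasDerivAt_id x))

/-- The constant distribution `1` has vanishing time derivative. -/
theorem integral_integral_fderiv_fst_eq_zero {φ : ℝ × ℝ → ℝ} (hφ : ContDiff ℝ 1 φ)
    (hc : HasCompactSupport φ) : ∫ t : ℝ, ∫ x : ℝ, fderiv ℝ φ (t, x) (1, 0) = 0 := by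
  have hd : Continuous fun p => fderiv ℝ φ p (1, 0) :=
    (hφ.continuous_fderiv one_ne_zero).clm_apply continuous_const
  have hdc : HasCompactSupport fun p => fderiv ℝ φ p (1, 0) := hc.fderiv_apply ℝ _
  rw [integral_integral_swap (f := fun t x => fderiv ℝ φ (t, x) (1, 0))
    (hd.integrable_of_hasCompactSupport hdc)]
  refine integral_eq_zero_of_ae (Filter.Eventually.of_forall fun x => ?_)
  have hx : Continuous fun _ : ℝ => x := continuous_const
  exact integral_eq_zero_of_hasDerivAt_of_integrable
    (fun t => (hφ.differentiable one_ne_zero (t, x)).hasFDerivAt.hasDerivAt_fst)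
    (Continuous.integrable_of_hasCompactSupport (by fun_prop) (hdc.comp_graph hx))
    (Continuous.integrable_of_hasCompactSupport (hφ.continuous.comp (by fun_prop))
      (hc.comp_graph hx))

/-- Pairing a step function with a derivative gives the jump times the value at the jump. -/
theorem integral_step_mul_deriv {f : ℝ → ℝ} (hf : ContDiff ℝ 1 f) (hc : HasCompactSupport f)
    (c₁ c₂ b : ℝ) :
    ∫ x : ℝ, (if x < b then c₁ else c₂) * deriv f x = (c₁ - c₂) * f b := by
  have hint : Integrable (deriv f) :=
    (hf.continuous_deriv le_rfl).integrable_of_hasCompactSupport hc.deriv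
  have hsplit : (fun x => (if x < b then c₁ else c₂) * deriv f x) =
      fun x => (c₁ - c₂) * (Set.Iio b).indicator (deriv f) x + c₂ * deriv f x := by
    ext x
    by_cases h : x < b
    · simp [h]
      ring
    · simp [h]
  have hzero : ∫ x, deriv f x = 0 :=
    integral_eq_zero_of_hasDerivAt_of_integrable
      (fun x => (hf.differentiable one_ne_zero x).hasDerivAt) hint
      (hf.continuous.integrable_of_hasCompactSupport hc)
  rw [hsplit, integral_add ((hint.indicator measurableSet_Iio).const_mul _) (hint.const_mul _),
    integral_const_mul, integral_const_mul, integral_indicator measurableSet_Iio,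
    ← integral_Iic_eq_integral_Iio, hc.integral_Iic_deriv_eq hf, hzero]
  ring

/-- Integration by parts along the line `x = αt` with weight `t`. -/
theorem integral_mul_fderiv_fst_line {φ : ℝ × ℝ → ℝ} (hφ : ContDiff ℝ 1 φ)
    (hc : HasCompactSupport φ) (α : ℝ) :
    ∫ t : ℝ, t * fderiv ℝ φ (t, α * t) (1, 0) =
      -(∫ t : ℝ, φ (t, α * t)) - α * ∫ t : ℝ, t * fderiv ℝ φ (t, α * t) (0, 1) := by
  have hline : Continuous fun t : ℝ => α * t := by fun_prop
  have hd (v : ℝ × ℝ) : Integrable fun t : ℝ => t * fderiv ℝ φ (t, α * t) v := by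
    refine Continuous.integrable_of_hasCompactSupport ?_
      ((hc.fderiv_apply ℝ v).comp_graph hline).mul_left
    exact continuous_id.mul
      (((hφ.continuous_fderiv one_ne_zero).comp (by fun_prop)).clm_apply continuous_const)
  have hcont : Continuous fun t : ℝ => φ (t, α * t) := hφ.continuous.comp (by fun_prop)
  have hi : Integrable fun t : ℝ => φ (t, α * t) :=
    hcont.integrable_of_hasCompactSupport (hc.comp_graph hline)
  have hderiv (t : ℝ) : HasDerivAt (fun s => s * φ (s, α * s))
      (φ (t, α * t) + (t * fderiv ℝ φ (t, α * t) (1, 0) +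
        α * (t * fderiv ℝ φ (t, α * t) (0, 1)))) t := by
    refine ((hasDerivAt_id' t).fun_mul (hφ.differentiable one_ne_zero
      (t, α * t)).hasFDerivAt.hasDerivAt_comp_line).congr_deriv ?_
    ring
  have hsum : Integrable fun t : ℝ => t * fderiv ℝ φ (t, α * t) (1, 0) +
      α * (t * fderiv ℝ φ (t, α * t) (0, 1)) := (hd _).add ((hd _).const_mul α)
  have hzero := integral_eq_zero_of_hasDerivAt_of_integrable hderiv
    (hi.add hsum)
    ((continuous_id.mul hcont).integrable_of_hasCompactSupport (hc.comp_graph hline).mul_left)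
  rw [integral_add hi hsum, integral_add (hd _) ((hd _).const_mul α), integral_const_mul] at hzero
  linarith

/-- There is a test function on the strip `(0,T) × ℝ` whose spatial derivative pairs positively
with `t δ(x - αt)`. -/
theorem exists_testFunction_integral_fderiv_snd_line_pos {T : ℝ} (hT : 0 < T) (α : ℝ) :
    ∃ φ : ℝ × ℝ → ℝ, ContDiff ℝ (⊤ : ℕ∞) φ ∧ HasCompactSupport φ ∧
      Function.support φ ⊆ Set.Ioo 0 T ×ˢ Set.univ ∧
      0 < ∫ t : ℝ, t * fderiv ℝ φ (t, α * t) (0, 1) := by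
  let B : ContDiffBump ((T / 2, α * (T / 2)) : ℝ × ℝ) :=
    ⟨T / 4, T / 2, by positivity, by linarith⟩
  have hB : Function.support B ⊆ Set.Ioo 0 T ×ˢ Set.univ := by
    rw [B.support_eq, ← ball_prod_same, Real.ball_eq_Ioo]
    refine Set.prod_mono (Set.Ioo_subset_Ioo ?_ ?_) (Set.subset_univ _) <;> simp [B]
  have hBd : ContDiff ℝ (⊤ : ℕ∞) B := B.contDiff
  have hd (t : ℝ) : fderiv ℝ (fun p : ℝ × ℝ => (p.2 - α * p.1) * B p) (t, α * t) (0, 1) =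
      B (t, α * t) := by
    have h1 : DifferentiableAt ℝ (fun p : ℝ × ℝ => (p.2 - α * p.1) * B p) (t, α * t) :=
      DifferentiableAt.mul (by fun_prop) (hBd.differentiable (by simp) _)
    have h2 : HasDerivAt (fun y => (y - α * t) * B (t, y)) (B (t, α * t)) (α * t) := by
      simpa using ((hasDerivAt_id' (α * t)).sub_const (α * t)).fun_mul
        (hBd.differentiable (by simp) (t, α * t)).hasFDerivAt.hasDerivAt_snd
    exact h1.hasFDerivAt.hasDerivAt_snd.unique h2
  refine ⟨fun p => (p.2 - α * p.1) * B p, ContDiff.mul (by fun_prop) hBd,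
    B.hasCompactSupport.mul_left, (Function.support_mul_subset_right _ _).trans hB, ?_⟩
  simp_rw [hd]
  refine Continuous.integral_pos_of_hasCompactSupport_nonneg_nonzero (x := T / 2)
    (continuous_id.mul (B.continuous.comp (by fun_prop)))
    (B.hasCompactSupport.comp_graph (g := fun t => α * t) (by fun_prop)).mul_left
    (fun t => ?_) ?_
  · by_cases h : B (t, α * t) = 0
    · simp [h]
    · exact mul_nonneg (hB h).1.1.le B.nonneg
  · exact mul_ne_zero (by positivity)
      (ne_of_gt (B.pos_of_mem_ball (Metric.mem_ball_self B.rOut_pos)))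

/-- The distributional residual of the equation is
`((c₁ + c₂) / 2 - α) (c₁ - c₂) t δ'(x - αt)`, up to sign. -/
theorem residual_eq {φ : ℝ × ℝ → ℝ} (hφ : ContDiff ℝ 1 φ) (hc : HasCompactSupport φ)
    (c₁ c₂ α : ℝ) :
    ((∫ t : ℝ, ∫ x : ℝ, fderiv ℝ φ (t, x) (1, 0))
        + (∫ t : ℝ, t * (c₁ - c₂) * fderiv ℝ φ (t, α * t) (1, 0)))
      + ((∫ t : ℝ, ∫ x : ℝ, (if x < α * t then c₁ else c₂) * fderiv ℝ φ (t, x) (0, 1))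
        + (∫ t : ℝ, t / 2 * (c₁ + c₂) * (c₁ - c₂) * fderiv ℝ φ (t, α * t) (0, 1)))
      = (c₁ - c₂) * ((c₁ + c₂) / 2 - α) * ∫ t : ℝ, t * fderiv ℝ φ (t, α * t) (0, 1) := by
  have hstep (t : ℝ) : ∫ x : ℝ, (if x < α * t then c₁ else c₂) * fderiv ℝ φ (t, x) (0, 1) =
      (c₁ - c₂) * φ (t, α * t) := by
    have hs : ContDiff ℝ 1 fun x : ℝ => φ (t, x) := by fun_prop
    rw [← integral_step_mul_deriv hs (hc.comp_prodMk_left t) c₁ c₂ (α * t)]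
    congr! 3 with x
    exact (hφ.differentiable one_ne_zero (t, x)).hasFDerivAt.hasDerivAt_snd.deriv.symm
  have h1 : ∫ t : ℝ, t * (c₁ - c₂) * fderiv ℝ φ (t, α * t) (1, 0) =
      (c₁ - c₂) * ∫ t : ℝ, t * fderiv ℝ φ (t, α * t) (1, 0) := by
    rw [← integral_const_mul]
    congr! 2 with t
    ring
  have h2 : ∫ t : ℝ, t / 2 * (c₁ + c₂) * (c₁ - c₂) * fderiv ℝ φ (t, α * t) (0, 1) =
      (c₁ + c₂) / 2 * (c₁ - c₂) * ∫ t : ℝ, t * fderiv ℝ φ (t, α * t) (0, 1) := by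
    rw [← integral_const_mul]
    congr! 2 with t
    ring
  simp_rw [hstep]
  rw [integral_integral_fderiv_fst_eq_zero hφ hc, h1, h2, integral_const_mul,
    integral_mul_fderiv_fst_line hφ hc]
  ring

/-- With the model product `[H(αt-x)·δ(x-αt)] = δ(x-αt)/2`, so that
`[a·u] = c₁H(αt-x) + c₂H(x-αt) + (t/2)(c₁+c₂)(c₁-c₂)δ(x-αt)` for
`a = c₁H(αt-x) + c₂H(x-αt)` and `u = 1 + t(c₁-c₂)δ(x-αt)`, the distribution `u`
satisfies `∂_t u + ∂_x[a·u] = 0` in `𝒟'((0,T)×ℝ)` if and only if `α = (c₁+c₂)/2`. -/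
theorem stmt_14 (T c₁ c₂ α : ℝ) (hT : 0 < T) (hc : c₂ < c₁)
    (hα : α ∈ Set.Icc c₂ c₁)
    (a : ℝ → ℝ → ℝ)
    (ha : ∀ t x : ℝ, a t x = if x < α * t then c₁ else c₂) :
    (∀ φ : ℝ × ℝ → ℝ, ContDiff ℝ (⊤ : ℕ∞) φ → HasCompactSupport φ →
      (Function.support φ ⊆ Set.Ioo 0 T ×ˢ Set.univ) →
      ((∫ t : ℝ, ∫ x : ℝ, fderiv ℝ φ (t, x) (1, 0))
        + (∫ t : ℝ, t * (c₁ - c₂) * fderiv ℝ φ (t, α * t) (1, 0)))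
      + ((∫ t : ℝ, ∫ x : ℝ, a t x * fderiv ℝ φ (t, x) (0, 1))
        + (∫ t : ℝ, t / 2 * (c₁ + c₂) * (c₁ - c₂) * fderiv ℝ φ (t, α * t) (0, 1)))
      = 0)
    ↔ α = (c₁ + c₂) / 2 := by
  simp_rw [ha]
  constructor
  · intro h
    obtain ⟨φ, hφ, hcs, hsupp, hpos⟩ := exists_testFunction_integral_fderiv_snd_line_pos hT α
    have h0 := h φ hφ hcs hsupp
    rw [residual_eq (hφ.of_le (by simp)) hcs] at h0
    have hne : c₁ - c₂ ≠ 0 := (sub_pos.2 hc).ne'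
    have h1 : (c₁ + c₂) / 2 - α = 0 := by simpa [hne, hpos.ne'] using h0
    linarith
  · intro h φ hφ hcs _
    rw [residual_eq (hφ.of_le (by simp)) hcs, h]
    ring
end

section
/- Let a(x) = -x log|x| ρ(x) (extended by 0 at x = 0) where ρ ∈ C¹ is even, nonnegative, supported in [-1,1], ρ(0) > 0, with ρ' < 0 on (0,1). With v_ε(x) = ε^{-1/2}ρ(x/ε), the quadratic form ⟨a v_ε', v_ε⟩_{L²} = -2∫_0^1 ρ(εz) z log|εz| ρ'(z)ρ(z) dz tends to -∞ as ε → 0, while ‖v_ε‖_{L²} = 1; hence there is no constant C with Re⟨a v', v⟩_{L²} ≥ -C‖v‖_{L²}² for all v ∈ C_c^∞(ℝ). -/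
open MeasureTheory intervalIntegral Filter

/-- The squared amplitude of the `L²`-normalised dilation by `ε` is `ε⁻¹`. -/
theorem rpow_neg_half_mul_self {ε : ℝ} (hε : 0 < ε) :
    ε ^ (-(1:ℝ)/2) * ε ^ (-(1:ℝ)/2) = ε⁻¹ := by
  rw [← Real.rpow_add hε, ← Real.rpow_neg_one]
  norm_num

theorem integral_sq_dilation (φ : ℝ → ℝ) {ε : ℝ} (hε : 0 < ε) :
    ∫ x : ℝ, (ε ^ (-(1:ℝ)/2) * φ (x / ε)) ^ 2 = ∫ x : ℝ, φ x ^ 2 := by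
  have h : ∀ x : ℝ, (ε ^ (-(1:ℝ)/2) * φ (x / ε)) ^ 2 = ε⁻¹ * φ (x / ε) ^ 2 := fun x => by
    rw [mul_pow, sq (ε ^ _), rpow_neg_half_mul_self hε]
  simp_rw [h]
  rw [MeasureTheory.integral_const_mul,
    Measure.integral_comp_div (fun y => φ y ^ 2) ε, abs_of_pos hε, smul_eq_mul,
    inv_mul_cancel_left₀ hε.ne']

theorem eq_zero_of_one_lt {φ : ℝ → ℝ} (hsupp : Function.support φ ⊆ Set.Icc (-1 : ℝ) 1)
    {x : ℝ} (hx : 1 < x) : φ x = 0 := by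
  by_contra h
  exact absurd (hsupp h).2 (not_le.2 hx)

theorem deriv_neg_of_even {φ : ℝ → ℝ} (heven : ∀ x, φ (-x) = φ x) (x : ℝ) :
    deriv φ (-x) = -deriv φ x := by
  have h := deriv_comp_neg φ x
  simp_rw [heven] at h
  linarith

/-- The quadratic form of `-x log|x| ρ(x) ∂ₓ` on a dilation of an even function. -/
theorem integral_logCoeff_dilation {ρ φ : ℝ → ℝ} (hρeven : ∀ x, ρ (-x) = ρ x)
    (heven : ∀ x, φ (-x) = φ x) (hsupp : Function.support φ ⊆ Set.Icc (-1 : ℝ) 1)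
    {ε : ℝ} (hε : 0 < ε) :
    ∫ x : ℝ, -x * Real.log |x| * ρ x * deriv (fun y => ε ^ (-(1:ℝ)/2) * φ (y / ε)) x
        * (ε ^ (-(1:ℝ)/2) * φ (x / ε))
      = -2 * ∫ z in (0:ℝ)..1, ρ (ε * z) * z * Real.log |ε * z| * deriv φ z * φ z := by
  have hd : ∀ x, deriv (fun y => ε ^ (-(1:ℝ)/2) * φ (y / ε)) x
      = ε ^ (-(1:ℝ)/2) * (ε⁻¹ * deriv φ (x / ε)) := fun x => by
    have h := deriv_comp_mul_left ε⁻¹ φ x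
    simp only [smul_eq_mul] at h
    simp_rw [div_eq_inv_mul _ ε]
    rw [deriv_const_mul_field, h]
  set G : ℝ → ℝ := fun z => ρ (ε * z) * z * Real.log |ε * z| * deriv φ z * φ z with hG
  have hscale : ∀ x : ℝ, -x * Real.log |x| * ρ x
      * deriv (fun y => ε ^ (-(1:ℝ)/2) * φ (y / ε)) x * (ε ^ (-(1:ℝ)/2) * φ (x / ε))
      = -ε⁻¹ * G (x / ε) := fun x => by
    have hx : ε * (x / ε) = x := mul_div_cancel₀ x hε.ne'
    rw [hd]
    simp only [hG, hx]
    linear_combination (-x * Real.log |x| * ρ x * ε⁻¹ * deriv φ (x / ε) * φ (x / ε))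
      * rpow_neg_half_mul_self hε
  have hGabs : ∀ z, G z = G |z| := fun z => by
    rcases abs_choice z with h | h
    · rw [h]
    · rw [h]
      simp only [hG, mul_neg, hρeven, heven, deriv_neg_of_even heven, abs_neg]
      ring
  have hhalf : ∫ z, G z = 2 * ∫ z in Set.Ioi (0:ℝ), G z := by
    rw [← integral_comp_abs]
    exact integral_congr_ae (ae_of_all _ hGabs)
  have hunit : ∫ z in Set.Ioi (0:ℝ), G z = ∫ z in (0:ℝ)..1, G z := by
    rw [intervalIntegral.integral_of_le zero_le_one]
    refine setIntegral_eq_of_subset_of_forall_sdiff_eq_zero measurableSet_Ioi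
      Set.Ioc_subset_Ioi_self fun z hz => ?_
    have h1 : 1 < z := by
      by_contra h
      exact hz.2 ⟨hz.1, not_lt.1 h⟩
    simp [hG, eq_zero_of_one_lt hsupp h1]
  simp_rw [hscale]
  rw [MeasureTheory.integral_const_mul, Measure.integral_comp_div G ε, abs_of_pos hε,
    smul_eq_mul, hhalf, hunit]
  field_simp

/-- Integrating `(z φ²)'` over the unit interval shows that the weighted form is negative. -/
theorem integral_mul_deriv_mul_self_neg {φ : ℝ → ℝ} (hφ : ContDiff ℝ 1 φ) (h0 : 0 < φ 0)
    (h1 : φ 1 = 0) : ∫ z in (0:ℝ)..1, z * deriv φ z * φ z < 0 := by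
  have hc : Continuous φ := hφ.continuous
  have hc' : Continuous (deriv φ) := hφ.continuous_deriv le_rfl
  have hderiv : ∀ z ∈ Set.uIcc (0:ℝ) 1,
      HasDerivAt (fun y => y * φ y ^ 2) (φ z ^ 2 + 2 * (z * deriv φ z * φ z)) z := fun z _ => by
    have hφz := ((hφ.differentiable one_ne_zero) z).hasDerivAt
    refine ((hasDerivAt_id z).mul (hφz.pow 2)).congr_deriv ?_
    simp
    ring
  have hftc := integral_eq_sub_of_hasDerivAt hderiv
    (Continuous.intervalIntegrable (by fun_prop) _ _)
  rw [intervalIntegral.integral_add (Continuous.intervalIntegrable (by fun_prop) _ _)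
    (Continuous.intervalIntegrable (by fun_prop) _ _),
    intervalIntegral.integral_const_mul] at hftc
  have hpos : 0 < ∫ z in (0:ℝ)..1, φ z ^ 2 :=
    intervalIntegral.integral_pos zero_lt_one (by fun_prop) (fun z _ => sq_nonneg _)
      ⟨0, by simp, by positivity⟩
  simp [h1] at hftc
  linarith

theorem eq_zero_at_one {φ : ℝ → ℝ} (hc : Continuous φ)
    (hsupp : Function.support φ ⊆ Set.Icc (-1 : ℝ) 1) : φ 1 = 0 := by
  have h : Tendsto φ (nhdsWithin 1 (Set.Ioi 1)) (nhds 0) :=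
    tendsto_const_nhds.congr' (by
      filter_upwards [self_mem_nhdsWithin] with x hx
      exact (eq_zero_of_one_lt hsupp hx).symm)
  exact tendsto_nhds_unique (hc.continuousWithinAt (s := Set.Ioi 1)) h

/-- For small `ε` the weight `ρ(εz) log|εz|` is at most `(ρ(0)/2) log ε` on the unit interval,
so the form is driven to `-∞` by the logarithm. -/
theorem tendsto_integral_logCoeff_atBot {ρ φ : ℝ → ℝ} (hρ : Continuous ρ) (hρ0 : 0 < ρ 0)
    (hφ : ContDiff ℝ 1 φ) (hpos : ∀ x, 0 ≤ φ x) (h0 : 0 < φ 0) (h1 : φ 1 = 0)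
    (hanti : ∀ x : ℝ, 0 < x → x < 1 → deriv φ x ≤ 0) :
    Tendsto (fun ε : ℝ =>
      -2 * ∫ z in (0:ℝ)..1, ρ (ε * z) * z * Real.log |ε * z| * deriv φ z * φ z)
      (nhdsWithin 0 (Set.Ioi 0)) atBot := by
  have hc : Continuous φ := hφ.continuous
  have hc' : Continuous (deriv φ) := hφ.continuous_deriv le_rfl
  set K := ∫ z in (0:ℝ)..1, z * deriv φ z * φ z with hKdef
  have hK : K < 0 := integral_mul_deriv_mul_self_neg hφ h0 h1
  have hlim : Tendsto (fun ε : ℝ => (-(ρ 0 * K)) * Real.log ε)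
      (nhdsWithin 0 (Set.Ioi 0)) atBot :=
    Real.tendsto_log_nhdsGT_zero.const_mul_atBot (by nlinarith)
  refine tendsto_atBot_mono' _ ?_ hlim
  obtain ⟨δ, hδ, hδρ⟩ := Metric.continuousAt_iff.1 hρ.continuousAt (ρ 0 / 2) (half_pos hρ0)
  have hmin : 0 < min δ 1 := lt_min hδ one_pos
  filter_upwards [Ioo_mem_nhdsGT hmin] with ε hε
  have hε0 : 0 < ε := hε.1
  have hεδ : ε < δ := hε.2.trans_le (min_le_left _ _)
  have hε1 : ε < 1 := hε.2.trans_le (min_le_right _ _)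
  have hcont : Continuous
      (fun z => ρ (ε * z) * z * Real.log |ε * z| * deriv φ z * φ z) := by
    have hlog : Continuous (fun z : ℝ => ε * z * Real.log (ε * z)) :=
      Real.continuous_mul_log.comp (continuous_const.mul continuous_id)
    have : (fun z => ρ (ε * z) * z * Real.log |ε * z| * deriv φ z * φ z)
        = fun z => ε⁻¹ * ρ (ε * z) * (ε * z * Real.log (ε * z)) * deriv φ z * φ z := by
      funext z
      rw [Real.log_abs]
      field_simp
    rw [this]
    fun_prop
  have hle : ∫ z in (0:ℝ)..1, (ρ 0 / 2 * Real.log ε) * (z * deriv φ z * φ z)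
      ≤ ∫ z in (0:ℝ)..1, ρ (ε * z) * z * Real.log |ε * z| * deriv φ z * φ z := by
    refine integral_mono_on_of_le_Ioo zero_le_one
      (Continuous.intervalIntegrable (by fun_prop) _ _) (hcont.intervalIntegrable _ _)
      fun z hz => ?_
    have hεz : 0 < ε * z := mul_pos hε0 hz.1
    have hεz' : ε * z < ε := mul_lt_of_lt_one_right hε0 hz.2
    have hρz : ρ 0 / 2 ≤ ρ (ε * z) := by
      have := hδρ (x := ε * z) (by
        rw [Real.dist_eq, sub_zero, abs_of_pos hεz]
        exact hεz'.trans hεδ)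
      rw [Real.dist_eq] at this
      linarith [(abs_lt.1 this).1]
    have hlogle : Real.log (ε * z) ≤ Real.log ε := Real.log_le_log hεz hεz'.le
    have hlogneg : Real.log ε < 0 := Real.log_neg hε0 hε1
    have hweight : ρ (ε * z) * Real.log (ε * z) ≤ ρ 0 / 2 * Real.log ε := by
      nlinarith
    have hneg : z * deriv φ z * φ z ≤ 0 :=
      mul_nonpos_of_nonpos_of_nonneg
        (mul_nonpos_of_nonneg_of_nonpos hz.1.le (hanti z hz.1 hz.2)) (hpos z)
    have := mul_le_mul_of_nonpos_right hweight hneg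
    rw [Real.log_abs]
    linarith
  rw [intervalIntegral.integral_const_mul, ← hKdef] at hle
  linarith

/-- The smooth even bump `x ↦ exp(-1/(1-x²))` supported in `[-1, 1]`. -/
noncomputable def evenBump (x : ℝ) : ℝ := expNegInvGlue (1 - x ^ 2)

theorem contDiff_evenBump {n : ℕ∞} : ContDiff ℝ n evenBump :=
  expNegInvGlue.contDiff.comp (contDiff_const.sub (contDiff_id.pow 2))

theorem support_evenBump_subset : Function.support evenBump ⊆ Set.Icc (-1 : ℝ) 1 := by
  intro x hx
  have h : ¬ 1 - x ^ 2 ≤ 0 := fun h => hx (expNegInvGlue.zero_of_nonpos h)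
  exact abs_le.1 ((sq_le_one_iff_abs_le_one x).1 (by linarith))

theorem deriv_evenBump_nonpos {x : ℝ} (hx : 0 < x) : deriv evenBump x ≤ 0 := by
  have hd : DifferentiableAt ℝ evenBump x :=
    (contDiff_evenBump (n := 1)).differentiable one_ne_zero x
  have hanti : AntitoneOn evenBump (Set.Ioi 0) := fun y hy z _ hyz =>
    expNegInvGlue.monotone (by
      have : y ^ 2 ≤ z ^ 2 := pow_le_pow_left₀ (le_of_lt hy) hyz 2
      linarith)
  rw [← derivWithin_of_isOpen isOpen_Ioi hx]
  exact hanti.derivWithin_nonpos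

/-- Failure of the Gårding inequality for the log-Lipschitz coefficient
`a(x) = -x log|x| ρ(x)`: with `v_ε(x) = ε^{-1/2}ρ(x/ε)` one has `‖v_ε‖_{L²} = 1`,
`⟨a v_ε', v_ε⟩ = -2∫_0^1 ρ(εz) z log|εz| ρ'(z)ρ(z) dz → -∞` as `ε → 0⁺`; hence there
is no constant `C` with `⟨a v', v⟩ ≥ -C‖v‖²` for all test functions `v`. -/
theorem stmt_18 (ρ : ℝ → ℝ) (hρC1 : ContDiff ℝ 1 ρ)
    (hρeven : ∀ x : ℝ, ρ (-x) = ρ x)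
    (hρpos : ∀ x : ℝ, 0 ≤ ρ x)
    (hρ0 : 0 < ρ 0)
    (hρsupp : Function.support ρ ⊆ Set.Icc (-1 : ℝ) 1)
    (hρnorm : ∫ x : ℝ, (ρ x) ^ 2 = 1)
    (hρ'neg : ∀ x : ℝ, 0 < x → x < 1 → deriv ρ x < 0)
    (a : ℝ → ℝ) (ha : ∀ x : ℝ, a x = -x * Real.log |x| * ρ x)
    (v : ℝ → ℝ → ℝ) (hv : ∀ ε x : ℝ, v ε x = ε ^ (-(1:ℝ)/2) * ρ (x / ε)) :
    (∀ ε : ℝ, 0 < ε → ∫ x : ℝ, (v ε x) ^ 2 = 1) ∧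
    (∀ ε : ℝ, 0 < ε →
      ∫ x : ℝ, a x * deriv (v ε) x * v ε x
        = -2 * ∫ z in (0:ℝ)..1, ρ (ε * z) * z * Real.log |ε * z| * deriv ρ z * ρ z) ∧
    Tendsto (fun ε : ℝ => ∫ x : ℝ, a x * deriv (v ε) x * v ε x)
      (nhdsWithin 0 (Set.Ioi 0)) atBot ∧
    ¬ ∃ C : ℝ, ∀ w : ℝ → ℝ, ContDiff ℝ (⊤ : ℕ∞) w → HasCompactSupport w →
      -C * ∫ x : ℝ, (w x) ^ 2 ≤ ∫ x : ℝ, a x * deriv w x * w x := by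
  obtain rfl : a = fun x => -x * Real.log |x| * ρ x := funext ha
  have hv' : ∀ ε, v ε = fun x => ε ^ (-(1:ℝ)/2) * ρ (x / ε) := fun ε => funext (hv ε)
  have hform : ∀ ε : ℝ, 0 < ε →
      ∫ x : ℝ, -x * Real.log |x| * ρ x * deriv (v ε) x * v ε x
        = -2 * ∫ z in (0:ℝ)..1, ρ (ε * z) * z * Real.log |ε * z| * deriv ρ z * ρ z := by
    intro ε hε
    rw [hv']
    exact integral_logCoeff_dilation hρeven hρeven hρsupp hε
  refine ⟨fun ε hε => ?_, hform, ?_, ?_⟩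
  · rw [hv', integral_sq_dilation ρ hε, hρnorm]
  · refine (tendsto_integral_logCoeff_atBot hρC1.continuous hρ0 hρC1 hρpos hρ0
      (eq_zero_at_one hρC1.continuous hρsupp) fun x h0 h1 => (hρ'neg x h0 h1).le).congr' ?_
    filter_upwards [self_mem_nhdsWithin] with ε hε
    exact (hform ε hε).symm
  · rintro ⟨C, hC⟩
    have heven : ∀ x, evenBump (-x) = evenBump x := fun x => by simp [evenBump]
    have hlim := tendsto_integral_logCoeff_atBot hρC1.continuous hρ0 (contDiff_evenBump (n := 1))
      (fun x => expNegInvGlue.nonneg _) (expNegInvGlue.pos_of_pos (by norm_num))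
      (by simp [evenBump]) fun x h0 _ => deriv_evenBump_nonpos h0
    obtain ⟨ε, hlt, hε⟩ := ((hlim.eventually_lt_atBot (-C * ∫ x, evenBump x ^ 2)).and
      self_mem_nhdsWithin).exists
    have hε : 0 < ε := hε
    have hcompact : HasCompactSupport evenBump :=
      HasCompactSupport.of_support_subset_isCompact isCompact_Icc support_evenBump_subset
    have hle := hC (fun x => ε ^ (-(1:ℝ)/2) * evenBump (x / ε))
      (contDiff_const.mul (contDiff_evenBump.comp (contDiff_id.div_const ε)))
      (by
        have := (hcompact.comp_homeomorph (Homeomorph.mulRight₀ ε⁻¹ (inv_ne_zero hε.ne'))).mul_left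
          (f := fun _ => ε ^ (-(1:ℝ)/2))
        exact this)
    rw [integral_sq_dilation evenBump hε,
      integral_logCoeff_dilation hρeven heven support_evenBump_subset hε] at hle
    exact absurd hlt (not_lt.2 hle)
end
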